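/- Let α, β, γ > 0 be real and t > 0. Writing F(t) = E_{α,β}^γ(t) and defining the Laguerreian difference Δ_L(t) = (F'(t))² − F(t) F''(t), one has t Δ_L(t) ≤ F(t) F'(t) = γ E_{α,β}^γ(t) · E_{α,α+β}^{γ+1}(t). -/

import Mathlib

open scoped BigOperators

/-- Pochhammer symbol `(γ)_k = Γ(γ+k)/Γ(γ)`. -/
noncomputable def poch (γ : ℝ) (k : ℕ) : ℝ := Real.Gamma (γ + k) / Real.Gamma γ

/-- The Prabhakar (three-parameter Mittag-Leffler) function
`E_{α,β}^γ(x) = ∑_{k≥0} (γ)_k x^k / (k! Γ(αk+β))`. -/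
noncomputable def prabhakar (α β γ x : ℝ) : ℝ :=
  ∑' k : ℕ, poch γ k * x ^ k / (k.factorial * Real.Gamma (α * k + β))

/-- The formal derivative of a coefficient sequence. -/
def derivCoeff (c : ℕ → ℝ) (k : ℕ) : ℝ := (k + 1) * c (k + 1)

theorem summable_derivCoeff {c : ℕ → ℝ} (hc : ∀ k, 0 ≤ c k)
    (hs : ∀ r : ℝ, 0 < r → Summable fun k => c k * r ^ k) (r : ℝ) (hr : 0 < r) :
    Summable fun k => derivCoeff c k * r ^ k := by
  have h := ((summable_nat_add_iff 1).2 (hs (2 * r) (by positivity))).mul_left (1 / r)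
  refine Summable.of_nonneg_of_le (fun k => ?_) (fun k => ?_) h
  · have := hc (k + 1)
    unfold derivCoeff
    positivity
  · have h2 : ((k : ℝ) + 1) ≤ 2 ^ (k + 1) := by
      exact_mod_cast (Nat.lt_two_pow_self (n := k + 1)).le
    have h3 : 1 / r * (c (k + 1) * (2 * r) ^ (k + 1)) = 2 ^ (k + 1) * (c (k + 1) * r ^ k) := by
      rw [mul_pow, pow_succ r]
      field_simp
    rw [h3, derivCoeff, mul_assoc]
    have := hc (k + 1)
    gcongr

theorem hasSum_nat_mul_of_derivCoeff {c : ℕ → ℝ} {t : ℝ}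
    (hs : Summable fun k => derivCoeff c k * t ^ k) :
    HasSum (fun k : ℕ => k * c k * t ^ k) (t * ∑' k, derivCoeff c k * t ^ k) := by
  rw [← hasSum_nat_add_iff' 1, Finset.sum_range_one, Nat.cast_zero, zero_mul, zero_mul, sub_zero]
  have h : (fun n : ℕ => ((n + 1 : ℕ) : ℝ) * c (n + 1) * t ^ (n + 1))
      = fun k => t * (derivCoeff c k * t ^ k) := by
    funext k
    simp only [derivCoeff]
    push_cast
    ring
  rw [h]
  exact hs.hasSum.mul_left t

theorem hasDerivAt_tsum_mul_pow {c : ℕ → ℝ} (hc : ∀ k, 0 ≤ c k)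
    (hs : ∀ r : ℝ, 0 < r → Summable fun k => c k * r ^ k) (x : ℝ) :
    HasDerivAt (fun y => ∑' k, c k * y ^ k) (∑' k, derivCoeff c k * x ^ k) x := by
  have hR : (0 : ℝ) < |x| + 1 := by positivity
  have hu : Summable fun k : ℕ => c k * (k * (|x| + 1) ^ (k - 1)) := by
    rw [← summable_nat_add_iff 1]
    refine (summable_derivCoeff hc hs _ hR).congr fun k => ?_
    simp only [derivCoeff, Nat.add_sub_cancel]
    push_cast
    ring
  have hbd : ∀ (k : ℕ) (y : ℝ), y ∈ Metric.ball (0 : ℝ) (|x| + 1) →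
      ‖c k * (k * y ^ (k - 1))‖ ≤ c k * (k * (|x| + 1) ^ (k - 1)) := by
    intro k y hy
    rw [mem_ball_zero_iff, Real.norm_eq_abs] at hy
    rw [norm_mul, norm_mul, norm_pow, Real.norm_of_nonneg (hc k), Real.norm_natCast,
      Real.norm_eq_abs]
    have := hc k
    gcongr
  have hx : x ∈ Metric.ball (0 : ℝ) (|x| + 1) := by simp
  have h0 : (0 : ℝ) ∈ Metric.ball (0 : ℝ) (|x| + 1) := by simpa using hR
  have h := hasDerivAt_tsum_of_isPreconnected hu Metric.isOpen_ball
    (convex_ball (0 : ℝ) (|x| + 1)).isPreconnected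
    (fun k y _ => (hasDerivAt_pow k y).const_mul (c k)) hbd h0
    (summable_of_ne_finset_zero (s := {0}) fun k hk => by
      simp only [Finset.mem_singleton] at hk; simp [hk]) hx
  refine h.congr_deriv ?_
  rw [(Summable.of_norm_bounded hu fun k => hbd k x hx).tsum_eq_zero_add]
  simp only [derivCoeff, Nat.cast_zero, zero_mul, mul_zero, zero_add, Nat.add_sub_cancel]
  refine tsum_congr fun k => ?_
  push_cast
  ring

/-- A power series with nonnegative coefficients is log-convex in `log t`. -/
theorem sq_mul_tsum_derivCoeff_le {c : ℕ → ℝ} (hc : ∀ k, 0 ≤ c k)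
    (hs : ∀ r : ℝ, 0 < r → Summable fun k => c k * r ^ k) {t : ℝ} (ht : 0 < t) :
    t * ((∑' k, derivCoeff c k * t ^ k) ^ 2
        - (∑' k, c k * t ^ k) * ∑' k, derivCoeff (derivCoeff c) k * t ^ k)
      ≤ (∑' k, c k * t ^ k) * ∑' k, derivCoeff c k * t ^ k := by
  have hc' : ∀ k, 0 ≤ derivCoeff c k := fun k => by
    have := hc (k + 1)
    unfold derivCoeff
    positivity
  have hs' := summable_derivCoeff hc hs
  have H0 := (hs t ht).hasSum
  have H1 := hasSum_nat_mul_of_derivCoeff (hs' t ht)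
  have H2' := hasSum_nat_mul_of_derivCoeff (summable_derivCoeff hc' hs' t ht)
  have H2 : HasSum (fun k : ℕ => (k : ℝ) ^ 2 * c k * t ^ k)
      (t * (∑' k, derivCoeff c k * t ^ k
        + t * ∑' k, derivCoeff (derivCoeff c) k * t ^ k)) := by
    rw [← hasSum_nat_add_iff' 1, Finset.sum_range_one, Nat.cast_zero, zero_pow two_ne_zero,
      zero_mul, zero_mul, sub_zero]
    have h : (fun n : ℕ => ((n + 1 : ℕ) : ℝ) ^ 2 * c (n + 1) * t ^ (n + 1))
        = fun k : ℕ => t * (derivCoeff c k * t ^ k + k * derivCoeff c k * t ^ k) := by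
      funext k
      simp only [derivCoeff]
      push_cast
      ring
    rw [h]
    exact ((hs' t ht).hasSum.add H2').mul_left t
  set A := ∑' k, c k * t ^ k
  set B := ∑' k, derivCoeff c k * t ^ k
  set C := ∑' k, derivCoeff (derivCoeff c) k * t ^ k
  have hquad : ∀ l : ℝ, 0 ≤ A * (l * l) + (-(2 * (t * B))) * l + t * (B + t * C) := by
    intro l
    have h := ((H0.mul_left (l * l)).add (H1.mul_left (-(2 * l)))).add H2
    have h' := h.nonneg fun k => by
      have e : l * l * (c k * t ^ k) + -(2 * l) * (k * c k * t ^ k) + (k : ℝ) ^ 2 * c k * t ^ k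
          = (l - k) ^ 2 * (c k * t ^ k) := by ring
      have := hc k
      rw [e]
      positivity
    linarith
  have hd := discrim_le_zero hquad
  unfold discrim at hd
  have : 0 ≤ t * (A * B - t * (B ^ 2 - A * C)) := by linarith
  linarith [nonneg_of_mul_nonneg_right this ht]

theorem rpow_mul_exp_neg_le_Gamma {M y : ℝ} (hM : 0 < M) (hy : 1 ≤ y) :
    M ^ (y - 1) * Real.exp (-M) ≤ Real.Gamma y := by
  have hy0 : 0 < y := by linarith
  rw [Real.Gamma_eq_integral hy0, mul_comm, ← integral_exp_neg_Ioi,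
    ← MeasureTheory.integral_mul_const]
  have hI := Real.GammaIntegral_convergent hy0
  have hsub : Set.Ioi M ⊆ Set.Ioi 0 := Set.Ioi_subset_Ioi hM.le
  calc _ ≤ ∫ x in Set.Ioi M, Real.exp (-x) * x ^ (y - 1) := by
        refine MeasureTheory.setIntegral_mono_on
          ((integrableOn_exp_neg_Ioi M).mul_const _) (hI.mono_set hsub) measurableSet_Ioi ?_
        intro x hx
        have hx' : M ≤ x := le_of_lt hx
        have : 0 ≤ y - 1 := by linarith
        gcongr
    _ ≤ _ := by
        refine MeasureTheory.setIntegral_mono_set hI ?_ hsub.eventuallyLE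
        filter_upwards [MeasureTheory.ae_restrict_mem measurableSet_Ioi] with x hx
        have : 0 < x := hx
        simp only [Pi.zero_apply]
        positivity

theorem poch_pos {γ : ℝ} (hγ : 0 < γ) (k : ℕ) : 0 < poch γ k :=
  div_pos (Real.Gamma_pos_of_pos (by positivity)) (Real.Gamma_pos_of_pos hγ)

theorem poch_succ {γ : ℝ} (hγ : 0 < γ) (k : ℕ) : poch γ (k + 1) = (γ + k) * poch γ k := by
  unfold poch
  push_cast
  rw [← add_assoc, Real.Gamma_add_one (by positivity)]
  ring

theorem poch_succ_left {γ : ℝ} (hγ : 0 < γ) (k : ℕ) :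
    poch γ (k + 1) = γ * poch (γ + 1) k := by
  have := (Real.Gamma_pos_of_pos hγ).ne'
  unfold poch
  rw [Real.Gamma_add_one hγ.ne', show γ + ((k + 1 : ℕ) : ℝ) = γ + 1 + k by push_cast; ring]
  field_simp

/-- The coefficients of the Prabhakar function. -/
noncomputable def prabhakarCoeff (α β γ : ℝ) (k : ℕ) : ℝ :=
  poch γ k / (k.factorial * Real.Gamma (α * k + β))

theorem prabhakar_eq_tsum (α β γ x : ℝ) :
    prabhakar α β γ x = ∑' k, prabhakarCoeff α β γ k * x ^ k :=
  tsum_congr fun k => by unfold prabhakarCoeff; ring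

theorem prabhakarCoeff_pos {α β γ : ℝ} (hα : 0 < α) (hβ : 0 < β) (hγ : 0 < γ) (k : ℕ) :
    0 < prabhakarCoeff α β γ k := by
  have := poch_pos hγ k
  have := Real.Gamma_pos_of_pos (show 0 < α * k + β by positivity)
  unfold prabhakarCoeff
  positivity

theorem derivCoeff_prabhakarCoeff {α β γ : ℝ} (hγ : 0 < γ) (k : ℕ) :
    derivCoeff (prabhakarCoeff α β γ) k = γ * prabhakarCoeff α (α + β) (γ + 1) k := by
  unfold derivCoeff prabhakarCoeff
  rw [poch_succ_left hγ, Nat.factorial_succ,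
    show α * ((k + 1 : ℕ) : ℝ) + β = α * k + (α + β) by push_cast; ring]
  push_cast
  field_simp

theorem summable_poch_div_factorial {γ : ℝ} (hγ : 0 < γ) :
    Summable fun k : ℕ => poch γ k / k.factorial * (1 / 2 : ℝ) ^ k := by
  refine summable_of_ratio_test_tendsto_lt_one (l := 1 / 2) (by norm_num)
    (Filter.Eventually.of_forall fun k => ?_) ?_
  · have := poch_pos hγ k
    positivity
  · have h : Filter.Tendsto (fun k : ℕ => (1 + (γ - 1) / ((k : ℝ) + 1)) * (1 / 2))
        Filter.atTop (nhds ((1 + 0) * (1 / 2))) := by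
      refine (tendsto_const_nhds.add ?_).mul_const _
      exact tendsto_const_nhds.div_atTop
        (Filter.tendsto_atTop_add_const_right _ _ tendsto_natCast_atTop_atTop)
    rw [add_zero, one_mul] at h
    refine h.congr fun k => ?_
    have hp := poch_pos hγ k
    have hp' := poch_pos hγ (k + 1)
    rw [Real.norm_of_nonneg (by positivity), Real.norm_of_nonneg (by positivity),
      poch_succ hγ, Nat.factorial_succ, pow_succ]
    push_cast
    field_simp
    ring

theorem summable_prabhakarCoeff {α β γ : ℝ} (hα : 0 < α) (hβ : 0 < β) (hγ : 0 < γ)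
    (r : ℝ) (hr : 0 < r) : Summable fun k => prabhakarCoeff α β γ k * r ^ k := by
  set M : ℝ := (2 * r) ^ (1 / α) with hMdef
  have hM : 0 < M := by positivity
  have hMα : M ^ α = 2 * r := by
    rw [hMdef, ← Real.rpow_mul (by positivity), one_div_mul_cancel hα.ne', Real.rpow_one]
  set K : ℝ := (M ^ (β - 1) * Real.exp (-M))⁻¹ with hK
  refine Summable.of_norm_bounded_eventually_nat
    ((summable_poch_div_factorial hγ).mul_left K) ?_
  have hlarge : ∀ᶠ k : ℕ in Filter.atTop, 1 / α ≤ (k : ℝ) :=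
    tendsto_natCast_atTop_atTop.eventually_ge_atTop _
  filter_upwards [hlarge] with k hk
  have hk1 : 1 ≤ α * k + β := by
    rw [div_le_iff₀ hα] at hk
    linarith
  have hp := poch_pos hγ k
  have hc := prabhakarCoeff_pos hα hβ hγ k
  have hG := rpow_mul_exp_neg_le_Gamma hM hk1
  have hMk : M ^ (α * k + β - 1) = (2 * r) ^ k * M ^ (β - 1) := by
    rw [add_sub_assoc, Real.rpow_add hM, Real.rpow_mul hM.le, hMα, Real.rpow_natCast]
  rw [hMk] at hG
  rw [Real.norm_of_nonneg (by positivity)]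
  unfold prabhakarCoeff
  calc poch γ k / (k.factorial * Real.Gamma (α * k + β)) * r ^ k
      ≤ poch γ k / (k.factorial * ((2 * r) ^ k * M ^ (β - 1) * Real.exp (-M))) * r ^ k := by
        gcongr
    _ = K * (poch γ k / k.factorial * (1 / 2 : ℝ) ^ k) := by
        rw [hK, mul_pow, div_pow, one_pow]
        field_simp

/-- Bound for the Laguerreian difference: `t Δ_L(t) ≤ F(t)F'(t) = γ E_{α,β}^γ(t) E_{α,α+β}^{γ+1}(t)`. -/
theorem prabhakar_laguerre_difference_bound (α β γ t : ℝ) (hα : 0 < α) (hβ : 0 < β)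
    (hγ : 0 < γ) (ht : 0 < t) :
    t * ((deriv (fun x => prabhakar α β γ x) t) ^ 2
          - prabhakar α β γ t * deriv (deriv (fun x => prabhakar α β γ x)) t)
        ≤ prabhakar α β γ t * deriv (fun x => prabhakar α β γ x) t
      ∧ prabhakar α β γ t * deriv (fun x => prabhakar α β γ x) t
        = γ * prabhakar α β γ t * prabhakar α (α + β) (γ + 1) t := by
  have hc : ∀ k, 0 ≤ prabhakarCoeff α β γ k := fun k => (prabhakarCoeff_pos hα hβ hγ k).le
  have hs := summable_prabhakarCoeff hα hβ hγ
  have hc' : ∀ k, 0 ≤ derivCoeff (prabhakarCoeff α β γ) k := fun k => by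
    have := hc (k + 1)
    unfold derivCoeff
    positivity
  have hd : deriv (fun x => ∑' k, prabhakarCoeff α β γ k * x ^ k)
      = fun x => ∑' k, derivCoeff (prabhakarCoeff α β γ) k * x ^ k :=
    funext fun x => (hasDerivAt_tsum_mul_pow hc hs x).deriv
  simp only [prabhakar_eq_tsum, hd]
  rw [(hasDerivAt_tsum_mul_pow hc' (summable_derivCoeff hc hs) t).deriv]
  refine ⟨sq_mul_tsum_derivCoeff_le hc hs ht, ?_⟩
  simp only [derivCoeff_prabhakarCoeff hγ, mul_assoc, tsum_mul_left]
  ring
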